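/- For each natural number n, the set of digraphs G (up to isomorphism respecting embedding) that are connected, planar, prime, have incoming and outgoing edges alternating at every vertex, and admit a vertex v with at most n directed spanning subtrees of origin v, is finite. -/

import Mathlib

/-- A digraph: a (multi)graph in which multiple edges and loops are allowed,
together with an orientation.  An edge `e` runs from `src e` to `tgt e`. -/
structure MultiDigraph (V E : Type) where
  src : E → V
  tgt : E → V

namespace MultiDigraph

variable {V E : Type}

/-- One step from `a` to `b` along an edge belonging to `T`. -/
def step (G : MultiDigraph V E) (T : Set E) (a b : V) : Prop :=
  ∃ e ∈ T, G.src e = a ∧ G.tgt e = b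

/-- Reachability by a directed path using only edges of `T`. -/
def reach (G : MultiDigraph V E) (T : Set E) : V → V → Prop :=
  Relation.ReflTransGen (G.step T)

/-- `T` is a directed spanning subtree of `G` with origin `u`: no edge of `T`
ends at `u`, every other vertex is the terminal vertex of exactly one edge of
`T`, and every vertex is reachable from `u` through `T` (which forces
connectedness and the absence of cycles). -/
def IsSpanTree (G : MultiDigraph V E) (u : V) (T : Set E) : Prop :=
  (∀ e ∈ T, G.tgt e ≠ u) ∧
  (∀ w, w ≠ u → ∃! e, e ∈ T ∧ G.tgt e = w) ∧
  (∀ w, G.reach T u w)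

/-- The number of directed spanning subtrees of `G` with origin `u`. -/
noncomputable def treeCount (G : MultiDigraph V E) (u : V) : ℕ :=
  Set.ncard {T : Set E | G.IsSpanTree u T}

/-- The digraph `G \ e` obtained by deleting the edge `e`. -/
def delete (G : MultiDigraph V E) (e : E) : MultiDigraph V {f : E // f ≠ e} :=
  ⟨fun f => G.src f.1, fun f => G.tgt f.1⟩

/-- The digraph `G / e` obtained by contracting the edge `e` to a point:
the two endpoints of `e` are identified and `e` is removed. -/
def contract (G : MultiDigraph V E) (e : E) :
    MultiDigraph (Quot fun a b => a = G.src e ∧ b = G.tgt e) {f : E // f ≠ e} :=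
  ⟨fun f => Quot.mk _ (G.src f.1), fun f => Quot.mk _ (G.tgt f.1)⟩

end MultiDigraph

namespace MultiDigraph

variable {V E : Type}

/-- The endpoint of a dart: `(e, false)` sits at the initial vertex of `e`,
and `(e, true)` sits at the terminal vertex of `e`. -/
def dartVert (G : MultiDigraph V E) (d : E × Bool) : V :=
  if d.2 then G.tgt d.1 else G.src d.1

/-- One undirected step using an edge in `S`. -/
def ustep (G : MultiDigraph V E) (S : Set E) (a b : V) : Prop :=
  ∃ e ∈ S, (G.src e = a ∧ G.tgt e = b) ∨ (G.src e = b ∧ G.tgt e = a)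

/-- A (planar) digraph is prime if it has no loops, no cut vertex, and no
simple closed curve in the sphere meets its edges at exactly two points with
vertices on both sides; for a connected plane graph the last condition is
equivalent to saying that removing any (at most) two edges leaves the graph
connected. -/
def Prime (G : MultiDigraph V E) : Prop :=
  (∀ e : E, G.src e ≠ G.tgt e) ∧
  (∀ v a b : V, a ≠ v → b ≠ v →
    Relation.ReflTransGen
      (fun x y => x ≠ v ∧ y ≠ v ∧ G.ustep {e | G.src e ≠ v ∧ G.tgt e ≠ v} x y)
      a b) ∧
  (∀ e₁ e₂ : E, ∀ a b : V,
    Relation.ReflTransGen (G.ustep {e | e ≠ e₁ ∧ e ≠ e₂}) a b)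

end MultiDigraph

/-- A digraph together with a combinatorial planar embedding in the 2-sphere:
a rotation system `rot` (sending each dart to the next dart counterclockwise
around the same vertex), required to satisfy Euler's formula
`V - E + F = 2`, where the faces (regions) are the orbits of the face
permutation `d ↦ rot (d.1, !d.2)`. -/
structure PlanarDigraph (V E : Type) where
  G : MultiDigraph V E
  rot : E × Bool → E × Bool
  rot_vertex : ∀ d, G.dartVert (rot d) = G.dartVert d
  rot_bijective : Function.Bijective rot
  rot_cyclic : ∀ d d', G.dartVert d = G.dartVert d' → ∃ k : ℕ, rot^[k] d = d'
  euler : Nat.card V +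
      Nat.card (Quot fun d d' : E × Bool => d' = rot (d.1, !d.2)) =
    Nat.card E + 2

/-- Incoming and outgoing edges alternate around each vertex of `P`. -/
def PlanarDigraph.Alternating {V E : Type} (P : PlanarDigraph V E) : Prop :=
  ∀ d : E × Bool, (P.rot d).2 = !d.2

/-- A planar digraph with unspecified (bundled) vertex and edge types. -/
structure BundledPlanarDigraph where
  V : Type
  E : Type
  P : PlanarDigraph V E

/-- Isomorphism of bundled planar digraphs, respecting the embeddings (i.e.
the rotation systems). -/
def BundledPlanarDigraph.Iso (X Y : BundledPlanarDigraph) : Prop :=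
  ∃ (fV : X.V ≃ Y.V) (fE : X.E ≃ Y.E),
    (∀ e : X.E, Y.P.G.src (fE e) = fV (X.P.G.src e)) ∧
    (∀ e : X.E, Y.P.G.tgt (fE e) = fV (X.P.G.tgt e)) ∧
    (∀ d : X.E × Bool,
      Y.P.rot (fE d.1, d.2) = (fE (X.P.rot d).1, (X.P.rot d).2))

namespace MultiDigraph

variable {V E : Type}

lemma reach_mono' (G : MultiDigraph V E) {S T : Set E} (h : S ⊆ T) {a b : V}
    (hr : G.reach S a b) : G.reach T a b := by
  induction hr with
  | refl => exact Relation.ReflTransGen.refl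
  | tail _ hs ih =>
    obtain ⟨e, he, h1, h2⟩ := hs
    exact Relation.ReflTransGen.tail ih ⟨e, h he, h1, h2⟩

lemma reach_snoc (G : MultiDigraph V E) {T : Set E} {a : V} {e : E}
    (hr : G.reach T a (G.src e)) (he : e ∈ T) : G.reach T a (G.tgt e) :=
  Relation.ReflTransGen.tail hr ⟨e, he, rfl, rfl⟩

/-- first arrival at `w`. -/
lemma first_arrival (G : MultiDigraph V E) (T : Set E) (v w : V) {x : V}
    (hr : G.reach T v x) :
    G.reach {f | f ∈ T ∧ G.tgt f ≠ w} v x ∨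
    ∃ g ∈ T, G.tgt g = w ∧ G.reach {f | f ∈ T ∧ G.tgt f ≠ w} v (G.src g) := by
  induction hr with
  | refl => exact Or.inl Relation.ReflTransGen.refl
  | tail _ hs ih =>
    obtain ⟨e, he, rfl, rfl⟩ := hs
    rcases ih with ih | ih
    · by_cases h : G.tgt e = w
      · exact Or.inr ⟨e, he, h, ih⟩
      · exact Or.inl (G.reach_snoc ih ⟨he, h⟩)
    · exact Or.inr ih

lemma not_reach_avoid_self (G : MultiDigraph V E) (T : Set E) {v w : V} (h : w ≠ v) :
    ¬ G.reach {f | f ∈ T ∧ G.tgt f ≠ w} v w := by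
  intro hr
  rcases Relation.ReflTransGen.cases_tail hr with h1 | ⟨c, _, e, he, _, h2⟩
  · exact h h1
  · exact he.2 h2

/-- restricting the in-edges of `w` to a single good one keeps reachability. -/
lemma reach_restrict (G : MultiDigraph V E) (A : Set E) (v : V) (g : E) (hg : g ∈ A)
    (hp : G.reach {f | f ∈ A ∧ G.tgt f ≠ G.tgt g} v (G.src g)) {x : V}
    (hr : G.reach A v x) :
    G.reach {f | f ∈ A ∧ (G.tgt f ≠ G.tgt g ∨ f = g)} v x := by
  have hw : G.reach {f | f ∈ A ∧ (G.tgt f ≠ G.tgt g ∨ f = g)} v (G.tgt g) := by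
    apply reach_snoc
    · refine G.reach_mono' ?_ hp
      exact fun f hf => ⟨hf.1, Or.inl hf.2⟩
    · exact ⟨hg, Or.inr rfl⟩
  induction hr with
  | refl => exact Relation.ReflTransGen.refl
  | tail _ hs ih =>
    obtain ⟨e, he, rfl, rfl⟩ := hs
    by_cases h : G.tgt e = G.tgt g
    · rw [h]; exact hw
    · exact G.reach_snoc ih ⟨he, Or.inl h⟩

lemma exists_tree [Finite E] (G : MultiDigraph V E) (A : Set E) (v : V)
    (hA : ∀ x, G.reach A v x) : ∃ T ⊆ A, G.IsSpanTree v T := by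
  have hfin : (Set.univ : Set (Set E)).Finite := Set.toFinite _
  obtain ⟨T, hTA, hT⟩ := (Set.toFinite {T : Set E | ∀ x, G.reach T v x}).exists_le_minimal
    (a := A) hA
  have hreach : ∀ x, G.reach T v x := hT.1
  have hmin : ∀ S : Set E, S ⊆ T → (∀ x, G.reach S v x) → T ⊆ S := fun S hS h => hT.2 h hS
  refine ⟨T, hTA, ?_, ?_, hreach⟩
  · have := hmin {f | f ∈ T ∧ G.tgt f ≠ v} (fun f hf => hf.1) (by
      intro x
      have hr := hreach x
      induction hr with
      | refl => exact Relation.ReflTransGen.refl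
      | tail _ hs ih =>
        obtain ⟨e, he, rfl, rfl⟩ := hs
        by_cases h : G.tgt e = v
        · rw [h]; exact Relation.ReflTransGen.refl
        · exact G.reach_snoc ih ⟨he, h⟩)
    exact fun e he => (this he).2
  · intro w hw
    rcases G.first_arrival T v w (hreach w) with h | ⟨g, hg, rfl, hp⟩
    · exact absurd h (G.not_reach_avoid_self T hw)
    · have := hmin {f | f ∈ T ∧ (G.tgt f ≠ G.tgt g ∨ f = g)} (fun f hf => hf.1)
        (fun x => G.reach_restrict T v g hg hp (hreach x))
      refine ⟨g, ⟨hg, rfl⟩, ?_⟩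
      rintro y ⟨hy, hyt⟩
      rcases (this hy).2 with h | h
      · exact absurd hyt h
      · exact h

def Usable (G : MultiDigraph V E) (v : V) (A : Set E) (e : E) : Prop :=
  e ∈ A ∧ G.tgt e ≠ v ∧ G.reach {f | f ∈ A ∧ G.tgt f ≠ G.tgt e} v (G.src e)

lemma exists_tree_mem [Finite E] (G : MultiDigraph V E) (A : Set E) (v : V)
    (hA : ∀ x, G.reach A v x) (e : E) (he : G.Usable v A e) :
    ∃ T ⊆ A, G.IsSpanTree v T ∧ e ∈ T := by
  obtain ⟨T, hTA, hT⟩ := G.exists_tree {f | f ∈ A ∧ (G.tgt f ≠ G.tgt e ∨ f = e)} v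
    (fun x => G.reach_restrict A v e he.1 he.2.2 (hA x))
  refine ⟨T, fun f hf => (hTA hf).1, hT, ?_⟩
  obtain ⟨g, ⟨hg, hgt⟩, -⟩ := hT.2.1 (G.tgt e) he.2.1
  rcases (hTA hg).2 with h | h
  · exact absurd hgt h
  · exact h ▸ hg

lemma usable_or (G : MultiDigraph V E) (v : V) (e e' : E)
    (he : G.Usable v Set.univ e) (he' : G.Usable v Set.univ e') (hne : G.tgt e ≠ G.tgt e') :
    G.Usable v {f | f ≠ e'} e ∨ G.Usable v {f | f ≠ e} e' := by
  have n1 : e ≠ e' := fun h => hne (h ▸ rfl)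
  rcases G.first_arrival _ v (G.tgt e') he.2.2 with h | ⟨g, hg, hgt, hp⟩
  · left
    refine ⟨n1, he.2.1, G.reach_mono' ?_ h⟩
    rintro f ⟨⟨_, h1⟩, h2⟩
    exact ⟨fun h => h2 (h ▸ rfl), h1⟩
  · by_cases hge : g = e'
    · right
      subst hge
      refine ⟨n1.symm, he'.2.1, G.reach_mono' ?_ hp⟩
      rintro f ⟨⟨_, h1⟩, h2⟩
      exact ⟨fun h => h1 (h ▸ rfl), h2⟩
    · left
      rw [← hgt] at hp
      refine ⟨n1, he.2.1, G.reach_mono' ?_ (G.reach_restrict _ v g hg hp he.2.2)⟩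
      rintro f ⟨⟨_, h1⟩, h2⟩
      refine ⟨?_, h1⟩
      rintro rfl
      rcases h2 with h2 | h2
      · exact h2 hgt.symm
      · exact hge h2.symm

lemma separate [Finite E] (G : MultiDigraph V E) (v : V)
    (hR : ∀ e' x, G.reach {f | f ≠ e'} v x) (e e' : E) (hne : e ≠ e')
    (he : G.Usable v Set.univ e) (he' : G.Usable v Set.univ e') :
    ∃ T, G.IsSpanTree v T ∧ ¬ (e ∈ T ↔ e' ∈ T) := by
  by_cases ht : G.tgt e = G.tgt e'
  · obtain ⟨T, -, hT, heT⟩ := G.exists_tree_mem Set.univ v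
      (fun x => G.reach_mono' (Set.subset_univ _) (hR e x)) e he
    refine ⟨T, hT, fun h => hne ?_⟩
    exact (hT.2.1 _ he.2.1).unique ⟨heT, rfl⟩ ⟨h.1 heT, ht.symm⟩
  · rcases G.usable_or v e e' he he' ht with h | h
    · obtain ⟨T, hA, hT, heT⟩ := G.exists_tree_mem _ v (hR e') e h
      exact ⟨T, hT, fun h => hA (h.1 heT) rfl⟩
    · obtain ⟨T, hA, hT, heT⟩ := G.exists_tree_mem _ v (hR e) e' h
      exact ⟨T, hT, fun h => hA (h.2 heT) rfl⟩

lemma usable_card [Finite E] (G : MultiDigraph V E) (v : V)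
    (hR : ∀ e' x, G.reach {f | f ≠ e'} v x) :
    {e | G.Usable v Set.univ e}.ncard ≤ 2 ^ G.treeCount v := by
  unfold treeCount
  rw [← Set.ncard_powerset _ (Set.toFinite _)]
  refine Set.ncard_le_ncard_of_injOn (fun e => {T | G.IsSpanTree v T ∧ e ∈ T}) ?_ ?_
    (Set.toFinite _)
  · intro e _ T hT
    exact hT.1
  · intro e he e' he' h
    by_contra hne
    obtain ⟨T, hT, hn⟩ := G.separate v hR e e' hne he he'
    have := Set.ext_iff.1 h T
    simp only [Set.mem_ofPred_eq, hT, true_and] at this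
    exact hn this

lemma vert_card [Finite V] [Finite E] (G : MultiDigraph V E) (v : V)
    (hR : ∀ x, G.reach Set.univ v x) :
    Nat.card V ≤ {e | G.Usable v Set.univ e}.ncard + 1 := by
  have : ({v}ᶜ : Set V) ⊆ G.tgt '' {e | G.Usable v Set.univ e} := by
    intro w hw
    rcases G.first_arrival Set.univ v w (hR w) with h | ⟨g, hg, rfl, hp⟩
    · exact absurd h (G.not_reach_avoid_self _ hw)
    · exact ⟨g, ⟨hg, hw, hp⟩, rfl⟩
  have h1 := Set.ncard_le_ncard this (Set.toFinite _)
  have h2 := Set.ncard_image_le (f := G.tgt) (Set.toFinite {e | G.Usable v Set.univ e})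
  have h3 := Set.ncard_add_ncard_compl ({v} : Set V)
  rw [Set.ncard_singleton] at h3
  omega

def dom (G : MultiDigraph V E) (v x : V) : Set V :=
  {y | ¬ G.reach {f | f ∈ Set.univ ∧ G.tgt f ≠ y} v x}

lemma dom_ssubset (G : MultiDigraph V E) (v : V) (hR : ∀ x, G.reach Set.univ v x)
    {x y : V} (hxy : x ≠ y) (hy : y ∈ G.dom v x) : G.dom v y ⊂ G.dom v x := by
  have hxv : x ≠ v := by
    rintro rfl
    exact hy Relation.ReflTransGen.refl
  have key : ∀ z, z ≠ y → G.reach {f | f ∈ Set.univ ∧ G.tgt f ≠ z} v x →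
      G.reach {f | f ∈ Set.univ ∧ G.tgt f ≠ z} v y := by
    intro z _ hr
    rcases G.first_arrival _ v y hr with h | ⟨g, hg, rfl, hp⟩
    · refine absurd (G.reach_mono' ?_ h) hy
      exact fun f hf => ⟨trivial, hf.2⟩
    · exact G.reach_snoc (G.reach_mono' (fun f hf => hf.1) hp) hg
  refine ⟨?_, ?_⟩
  · intro z hz hr
    by_cases hzy : z = y
    · subst hzy; exact hy hr
    · exact hz (key z hzy hr)
  · intro hsub
    have hx : x ∈ G.dom v x := G.not_reach_avoid_self _ hxv
    refine hsub hx ?_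
    rcases G.first_arrival Set.univ v x (hR x) with h | ⟨g, hg, hgt, hp⟩
    · exact absurd h hx
    · rcases G.first_arrival _ v y hp with h | ⟨g', hg', rfl, hp'⟩
      · exfalso
        apply hy
        rw [← hgt]
        refine G.reach_snoc (G.reach_mono' ?_ h) ⟨trivial, ?_⟩
        · exact fun f hf => ⟨trivial, hf.2⟩
        · rw [hgt]; exact hxy
      · exact G.reach_snoc (G.reach_mono' (fun f hf => hf.1) hp') hg'

lemma edge_card [Finite V] [Finite E] (G : MultiDigraph V E) (v : V)
    (hR : ∀ x, G.reach Set.univ v x) (hl : ∀ e, G.src e ≠ G.tgt e)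
    (σ : E ≃ E) (hσ : ∀ e, G.src (σ e) = G.tgt e) :
    Nat.card E ≤ {e | G.Usable v Set.univ e}.ncard * (Nat.card V + 1) := by
  classical
  have := Fintype.ofFinite E
  set d : V → ℕ := fun x => (G.dom v x).ncard with hd
  have hsum : ∑ e, d (G.tgt e) = ∑ e, d (G.src e) := by
    rw [← Equiv.sum_comp σ (fun e => d (G.src e))]
    simp [hσ]
  have hdV : ∀ x, d x ≤ Nat.card V := fun x => Set.ncard_le_card _
  have hle : ∀ e, d (G.tgt e) + 1 ≤
      d (G.src e) + (if G.Usable v Set.univ e then Nat.card V + 1 else 0) := by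
    intro e
    split_ifs with h
    · have := hdV (G.tgt e); omega
    · have hlt : d (G.tgt e) < d (G.src e) := by
        apply Set.ncard_lt_ncard _ (Set.toFinite _)
        by_cases htv : G.tgt e = v
        · have : G.dom v (G.tgt e) = ∅ := by
            ext z
            simp only [dom, Set.mem_ofPred_eq, Set.mem_empty_iff_false, iff_false, not_not]
            rw [htv]; exact Relation.ReflTransGen.refl
          rw [this, Set.empty_ssubset]
          exact ⟨G.src e, G.not_reach_avoid_self _ (fun h => hl e (h.trans htv.symm))⟩
        · apply G.dom_ssubset v hR (hl e)
          exact fun hr => h ⟨trivial, htv, hr⟩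
      omega
  have := Finset.sum_le_sum (fun e (_ : e ∈ Finset.univ) => hle e)
  rw [Finset.sum_add_distrib, Finset.sum_add_distrib, hsum, ← Finset.sum_filter] at this
  simp only [Finset.sum_const, smul_eq_mul, Finset.card_univ, mul_one] at this
  rw [Set.ncard_eq_toFinset_card', Nat.card_eq_fintype_card]
  have h2 : ({e | G.Usable v Set.univ e} : Set E).toFinset = Finset.univ.filter (G.Usable v Set.univ) := by
    ext; simp
  have h3 : ∀ a b c : ℕ, a + b ≤ a + c → b ≤ c := fun a b c h => by omega
  convert h3 _ _ _ this using 2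
  convert congrArg Finset.card h2

/-- any cut is entered by two distinct edges. -/
lemma two_enter [Finite E] (G : MultiDigraph V E)
    (hc : ∀ a b : V, Relation.ReflTransGen (G.ustep Set.univ) a b) (hP : G.Prime)
    (σ : E ≃ E) (hσ : ∀ e, G.src (σ e) = G.tgt e) (D : Set V) (v w : V) (hv : v ∉ D) (hw : w ∈ D)
    (h1 : ∀ f f', G.src f ∉ D → G.tgt f ∈ D → G.src f' ∉ D → G.tgt f' ∈ D → f = f') : False := by
  classical
  have := Fintype.ofFinite E
  set I : Finset E := Finset.univ.filter (fun f => G.src f ∉ D ∧ G.tgt f ∈ D) with hI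
  set O : Finset E := Finset.univ.filter (fun f => G.src f ∈ D ∧ G.tgt f ∉ D) with hO
  have hcard : I.card = O.card := by
    have hs : ∑ e, (if G.tgt e ∈ D then 1 else 0) = ∑ e, (if G.src e ∈ D then 1 else 0) := by
      rw [← Equiv.sum_comp σ (fun e => if G.src e ∈ D then 1 else 0)]
      simp [hσ]
    have : ∑ e, ((if G.tgt e ∈ D then 1 else 0) + (if G.src e ∈ D ∧ G.tgt e ∉ D then 1 else 0))
        = ∑ e, ((if G.src e ∈ D then 1 else 0) + (if G.src e ∉ D ∧ G.tgt e ∈ D then 1 else 0)) := by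
      apply Finset.sum_congr rfl
      intro e _
      by_cases a : G.src e ∈ D <;> by_cases b : G.tgt e ∈ D <;> simp [a, b]
    rw [Finset.sum_add_distrib, Finset.sum_add_distrib, hs] at this
    rw [hI, hO, Finset.card_filter, Finset.card_filter]
    omega
  have hI1 : I.card ≤ 1 := by
    rw [Finset.card_le_one]
    intro a ha b hb
    simp only [hI, Finset.mem_filter, Finset.mem_univ, true_and] at ha hb
    exact h1 a b ha.1 ha.2 hb.1 hb.2
  have hO1 : O.card ≤ 1 := hcard ▸ hI1
  -- any path from outside to inside gives a crossing edge
  have cross : ∀ S : Set E, Relation.ReflTransGen (G.ustep S) v w → ∃ e ∈ S, e ∈ I ∨ e ∈ O := by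
    intro S hr
    by_contra hcon
    push Not at hcon
    have : ∀ x, Relation.ReflTransGen (G.ustep S) v x → x ∉ D := by
      intro x hx
      induction hx with
      | refl => exact hv
      | tail _ hs ih =>
        obtain ⟨e, he, h⟩ := hs
        have := hcon e he
        simp only [hI, hO, Finset.mem_filter, Finset.mem_univ, true_and] at this
        rcases h with ⟨rfl, rfl⟩ | ⟨rfl, rfl⟩ <;> tauto
    exact this w hr hw
  obtain ⟨e0, -, h0⟩ := cross _ (hc v w)
  have hpos : 0 < I.card ∧ 0 < O.card := by
    rcases h0 with h0 | h0
    · have := Finset.card_pos.2 ⟨e0, h0⟩; omega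
    · have := Finset.card_pos.2 ⟨e0, h0⟩; omega
  obtain ⟨i, hi⟩ := Finset.card_eq_one.1 (show I.card = 1 by omega)
  obtain ⟨o, ho⟩ := Finset.card_eq_one.1 (show O.card = 1 by omega)
  obtain ⟨e, he, h⟩ := cross _ (hP.2.2 i o v w)
  rw [hi, ho, Finset.mem_singleton, Finset.mem_singleton] at h
  exact h.elim he.1 he.2

lemma reach_del [Finite E] (G : MultiDigraph V E)
    (hc : ∀ a b : V, Relation.ReflTransGen (G.ustep Set.univ) a b) (hP : G.Prime)
    (σ : E ≃ E) (hσ : ∀ e, G.src (σ e) = G.tgt e) (v : V) (A : Set E)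
    (hA : ∀ f f', f ∉ A → f' ∉ A → f = f') (x : V) : G.reach A v x := by
  by_contra hx
  refine G.two_enter hc hP σ hσ {y | ¬ G.reach A v y} v x
    (fun h => h Relation.ReflTransGen.refl) hx ?_
  intro f f' h1 h2 h3 h4
  simp only [Set.mem_ofPred_eq, not_not] at h1 h2 h3 h4
  exact hA f f' (fun h => h2 (G.reach_snoc h1 h)) (fun h => h4 (G.reach_snoc h3 h))

end MultiDigraph

lemma PlanarDigraph.exists_sigma {V E : Type} [Finite E] (P : PlanarDigraph V E)
    (hA : P.Alternating) : ∃ σ : E ≃ E, ∀ e, P.G.src (σ e) = P.G.tgt e := by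
  have h2 : ∀ e, P.rot (e, true) = ((P.rot (e, true)).1, false) := by
    intro e
    have := hA (e, true)
    exact Prod.ext rfl this
  have hinj : Function.Injective (fun e => (P.rot (e, true)).1) := by
    intro a b hab
    have : P.rot (a, true) = P.rot (b, true) := by
      rw [h2 a, h2 b]; exact Prod.ext hab rfl
    exact (Prod.ext_iff.1 (P.rot_bijective.1 this)).1
  refine ⟨Equiv.ofBijective _ (Finite.injective_iff_bijective.1 hinj), fun e => ?_⟩
  have := P.rot_vertex (e, true)
  rw [h2 e] at this
  simpa [MultiDigraph.dartVert] using this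

/-- codes of labelled planar digraphs. -/
abbrev DCode (N : ℕ) : Type :=
  (a : Fin N) × (b : Fin N) ×
    ((Fin b → Fin a) × (Fin b → Fin a) × (Fin b × Bool → Fin b × Bool))

def HasDCode {N : ℕ} (X : BundledPlanarDigraph) (c : DCode N) : Prop :=
  ∃ (fV : X.V ≃ Fin c.1) (fE : X.E ≃ Fin c.2.1),
    (∀ e : X.E, c.2.2.1 (fE e) = fV (X.P.G.src e)) ∧
    (∀ e : X.E, c.2.2.2.1 (fE e) = fV (X.P.G.tgt e)) ∧
    (∀ d : X.E × Bool,
      c.2.2.2.2 (fE d.1, d.2) = (fE (X.P.rot d).1, (X.P.rot d).2))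

lemma HasDCode.iso {N : ℕ} {X Y : BundledPlanarDigraph} {c : DCode N}
    (hX : HasDCode X c) (hY : HasDCode Y c) : X.Iso Y := by
  obtain ⟨fV, fE, h1, h2, h3⟩ := hX
  obtain ⟨gV, gE, k1, k2, k3⟩ := hY
  refine ⟨fV.trans gV.symm, fE.trans gE.symm, fun e => ?_, fun e => ?_, fun d => ?_⟩
  · have := k1 (gE.symm (fE e))
    simp only [Equiv.apply_symm_apply, h1] at this
    simp [this]
  · have := k2 (gE.symm (fE e))
    simp only [Equiv.apply_symm_apply, h2] at this
    simp [this]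
  · have := k3 (gE.symm (fE d.1), d.2)
    simp only [Equiv.apply_symm_apply, h3 d] at this
    rw [Prod.ext_iff] at this
    apply Prod.ext
    · simp only [Equiv.trans_apply]
      rw [show fE (X.P.rot d).1 = _ from this.1]; simp
    · exact this.2.symm

lemma exists_dcode {N : ℕ} (X : BundledPlanarDigraph) [Finite X.V] [Finite X.E]
    (hV : Nat.card X.V < N) (hE : Nat.card X.E < N) : ∃ c : DCode N, HasDCode X c := by
  let fV := Finite.equivFin X.V
  let fE := Finite.equivFin X.E
  refine ⟨⟨⟨_, hV⟩, ⟨_, hE⟩, fun i => fV (X.P.G.src (fE.symm i)),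
    fun i => fV (X.P.G.tgt (fE.symm i)),
    fun d => (fE (X.P.rot (fE.symm d.1, d.2)).1, (X.P.rot (fE.symm d.1, d.2)).2)⟩, fV, fE, ?_, ?_, ?_⟩
  · intro e; simp
  · intro e; simp
  · intro d; simp

/-- **Finiteness of the set `Φ_n`.**  For each `n`, there are (up to
isomorphism respecting the embedding) only finitely many finite connected
prime planar digraphs, with incoming and outgoing edges alternating at every
vertex, possessing a vertex `v` with at most `n` directed spanning subtrees
of origin `v`. -/
theorem finitely_many_prime_planar_digraphs (n : ℕ) :
    ∃ L : List BundledPlanarDigraph, ∀ X : BundledPlanarDigraph,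
      Finite X.V → Finite X.E →
      (∀ a b : X.V, Relation.ReflTransGen (X.P.G.ustep Set.univ) a b) →
      X.P.G.Prime → X.P.Alternating →
      (∃ v : X.V, X.P.G.treeCount v ≤ n) →
      ∃ Y ∈ L, X.Iso Y := by
  classical
  set N := 2 ^ n * (2 ^ n + 2) + 2 with hN
  let L : List BundledPlanarDigraph := (Finset.univ : Finset (DCode N)).toList.flatMap
    (fun c => if h : ∃ Y, HasDCode Y c then [h.choose] else [])
  refine ⟨L, ?_⟩
  intro X hfV hfE hc hP hAlt ⟨v, hv⟩
  obtain ⟨σ, hσ⟩ := X.P.exists_sigma hAlt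
  have hR : ∀ x, X.P.G.reach Set.univ v x :=
    X.P.G.reach_del hc hP σ hσ v Set.univ (fun f _ h => absurd trivial h)
  have hR' : ∀ e' x, X.P.G.reach {f | f ≠ e'} v x := by
    intro e'
    refine X.P.G.reach_del hc hP σ hσ v _ ?_
    intro f f' h h'
    simp only [Set.mem_ofPred_eq, not_not] at h h'
    rw [h, h']
  have h1 := X.P.G.usable_card v hR'
  have h2 := X.P.G.vert_card v hR
  have h3 := X.P.G.edge_card v hR hP.1 σ hσ
  have h4 : 2 ^ X.P.G.treeCount v ≤ 2 ^ n := Nat.pow_le_pow_right (by norm_num) hv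
  have h5 := h1.trans h4
  have h6 : Nat.card X.V ≤ 2 ^ n + 1 := by omega
  have h7 : Nat.card X.E ≤ 2 ^ n * (2 ^ n + 2) := h3.trans (Nat.mul_le_mul h5 (by omega))
  have h8 : 2 ^ n ≤ 2 ^ n * (2 ^ n + 2) := Nat.le_mul_of_pos_right _ (by omega)
  obtain ⟨c, hcX⟩ := exists_dcode (N := N) X (by omega) (by omega)
  have hex : ∃ Y, HasDCode Y c := ⟨X, hcX⟩
  refine ⟨hex.choose, ?_, hcX.iso hex.choose_spec⟩
  simp only [L, List.mem_flatMap, Finset.mem_toList, Finset.mem_univ, true_and]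
  refine ⟨c, ?_⟩
  rw [dif_pos hex]
  simp
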